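/- (Choquet property.) The mixed capacity C̃_{BV^{p(·)}} is a Choquet capacity; in particular, for every Borel set E ⊂ Ω, C̃_{BV^{p(·)}}(E) = sup{C̃_{BV^{p(·)}}(K) : K ⊂ E, K compact} = inf{C̃_{BV^{p(·)}}(U) : E ⊂ U ⊂ Ω, U open}. -/

import Mathlib

open MeasureTheory Filter Topology ENNReal Set

noncomputable section

/-- Euclidean space `ℝⁿ`. -/
abbrev Eu (n : ℕ) : Type := EuclideanSpace ℝ (Fin n)

/-- The modular `ρ_{p(·)}(u) = ∫_Ω |u|^{p(x)} dx`. -/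
def vModular {n : ℕ} (p : Eu n → ℝ) (Ω : Set (Eu n)) (u : Eu n → ℝ) : ℝ≥0∞ :=
  ∫⁻ x in Ω, ENNReal.ofReal (|u x| ^ p x)

/-- The gradient modular `∫_Ω |∇u|^{p(x)} dx` (for a.e. differentiable `u`,
`fderiv` is the gradient). -/
def gradModular {n : ℕ} (p : Eu n → ℝ) (Ω : Set (Eu n)) (u : Eu n → ℝ) : ℝ≥0∞ :=
  ∫⁻ x in Ω, ENNReal.ofReal (‖fderiv ℝ u x‖ ^ p x)

/-- Membership in the variable exponent Lebesgue space `L^{p(·)}(Ω)`. -/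
def MemLpVar {n : ℕ} (p : Eu n → ℝ) (Ω : Set (Eu n)) (u : Eu n → ℝ) : Prop :=
  Measurable u ∧ ∃ l : ℝ, 0 < l ∧ vModular p Ω (fun x => u x / l) < ⊤

/-- The Luxemburg norm on `L^{p(·)}(Ω)`. -/
def luxNorm {n : ℕ} (p : Eu n → ℝ) (Ω : Set (Eu n)) (u : Eu n → ℝ) : ℝ :=
  sInf {l : ℝ | 0 < l ∧ vModular p Ω (fun x => u x / l) ≤ 1}

/-- Convergence `v i → u` in `L^{p(·)}(Ω)` (Luxemburg norm convergence). -/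
def LpTendsto {n : ℕ} (p : Eu n → ℝ) (Ω : Set (Eu n)) (v : ℕ → Eu n → ℝ)
    (u : Eu n → ℝ) : Prop :=
  Tendsto (fun i => luxNorm p Ω (fun x => v i x - u x)) atTop (𝓝 0)

/-- `u` is locally Lipschitz on `Ω`. -/
def LocLipOn {n : ℕ} (Ω : Set (Eu n)) (u : Eu n → ℝ) : Prop :=
  ∀ x ∈ Ω, ∃ K : NNReal, ∃ t ∈ 𝓝[Ω] x, LipschitzOnWith K u t

/-- The relaxed mixed pseudo-modular `ρ̃_{BV^{p(·)}(Ω)}(u)`: the infimum of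
`liminf_i ∫_Ω |∇u_i|^{p(x)} dx` over all sequences of locally Lipschitz functions
in `L^{p(·)}(Ω)` converging to `u` in `L^{p(·)}(Ω)`. -/
def bvModular {n : ℕ} (p : Eu n → ℝ) (Ω : Set (Eu n)) (u : Eu n → ℝ) : ℝ≥0∞ :=
  ⨅ (v : ℕ → Eu n → ℝ)
    (_ : (∀ i, LocLipOn Ω (v i) ∧ MemLpVar p Ω (v i)) ∧ LpTendsto p Ω v u),
    Filter.liminf (fun i => gradModular p Ω (v i)) atTop

/-- Membership in the mixed space `B̃V^{p(·)}(Ω)`. -/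
def MemBVt {n : ℕ} (p : Eu n → ℝ) (Ω : Set (Eu n)) (u : Eu n → ℝ) : Prop :=
  MemLpVar p Ω u ∧ bvModular p Ω u < ⊤

/-- The norm `‖u‖_{B̃V^{p(·)}}`. -/
def bvNorm {n : ℕ} (p : Eu n → ℝ) (Ω : Set (Eu n)) (u : Eu n → ℝ) : ℝ :=
  luxNorm p Ω u + sInf {l : ℝ | 0 < l ∧ bvModular p Ω (fun x => u x / l) ≤ 1}

/-- The admissible class `Ã(E)` for the mixed capacity. -/
def admissibleBV {n : ℕ} (p : Eu n → ℝ) (Ω E : Set (Eu n)) : Set (Eu n → ℝ) :=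
  {u | MemBVt p Ω u ∧ (∀ x ∈ Ω, 0 ≤ u x ∧ u x ≤ 1) ∧
       ∃ U : Set (Eu n), IsOpen U ∧ E ⊆ U ∧ ∀ x ∈ U ∩ Ω, u x = 1}

/-- The mixed BV-Sobolev capacity `C̃_{BV^{p(·)}}(E)` (with `inf ∅ = ∞`). -/
def bvCapacity {n : ℕ} (p : Eu n → ℝ) (Ω E : Set (Eu n)) : ℝ≥0∞ :=
  ⨅ (u : Eu n → ℝ) (_ : u ∈ admissibleBV p Ω E), vModular p Ω u + bvModular p Ω u

/-- Divergence of a vector field. -/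
def divg {n : ℕ} (φ : Eu n → Eu n) (x : Eu n) : ℝ :=
  ∑ i, fderiv ℝ φ x (EuclideanSpace.single i 1) i

/-- Total variation `‖Du‖(U)` on an open set `U`, via the defining supremum over
`C¹` vector fields compactly supported in `U` with `|φ| ≤ 1`. -/
def totVarOpen {n : ℕ} (U : Set (Eu n)) (u : Eu n → ℝ) : ℝ≥0∞ :=
  ⨆ (φ : Eu n → Eu n)
    (_ : ContDiff ℝ 1 φ ∧ HasCompactSupport φ ∧ tsupport φ ⊆ U ∧ ∀ x, ‖φ x‖ ≤ 1),
    ENNReal.ofReal (∫ x in U, u x * divg φ x)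

/-- Total variation `‖Du‖(A)` of a set `A ⊆ Ω`, extended from open sets. -/
def totVarIn {n : ℕ} (Ω A : Set (Eu n)) (u : Eu n → ℝ) : ℝ≥0∞ :=
  ⨅ (U : Set (Eu n)) (_ : IsOpen U ∧ A ⊆ U ∧ U ⊆ Ω), totVarOpen U u

/-- `g` is the weak (distributional) gradient of `u` on `Ω`. -/
def IsWeakGrad {n : ℕ} (Ω : Set (Eu n)) (u : Eu n → ℝ) (g : Eu n → Eu n) : Prop :=
  ∀ φ : Eu n → ℝ, ContDiff ℝ 1 φ → HasCompactSupport φ → tsupport φ ⊆ Ω →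
    ∀ i : Fin n,
      (∫ x in Ω, u x * (fderiv ℝ φ x (EuclideanSpace.single i 1))) =
        - ∫ x in Ω, g x i * φ x

/-- The Harjulehto–Hästö–Latvala mixed pseudo-modular
`ρ_{BV^{p(·)}(F)}(u) = ‖Du‖(F ∩ Y) + ∫_{F∖Y} |∇u|^{p(x)} dx`, where `Y = {p = 1}`
and `g` is the weak gradient of `u` on the Sobolev part. -/
def hhlModular {n : ℕ} (p : Eu n → ℝ) (Ω F : Set (Eu n)) (u : Eu n → ℝ)
    (g : Eu n → Eu n) : ℝ≥0∞ :=
  totVarIn Ω (F ∩ {x | p x = 1}) u +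
    ∫⁻ x in F \ {x | p x = 1}, ENNReal.ofReal (‖g x‖ ^ p x)

/-- The HHL mixed pseudo-modular for (smooth) functions whose gradient is `fderiv`. -/
def hhlModularSmooth {n : ℕ} (p : Eu n → ℝ) (Ω F : Set (Eu n)) (v : Eu n → ℝ) : ℝ≥0∞ :=
  totVarIn Ω (F ∩ {x | p x = 1}) v +
    ∫⁻ x in F \ {x | p x = 1}, ENNReal.ofReal (‖fderiv ℝ v x‖ ^ p x)

/-- Membership in the HHL space `BV^{p(·)}(Ω)`: `u ∈ L^{p(·)}(Ω)` and
`inf{λ > 0 : ρ_{BV^{p(·)}(Ω)}(u/λ) ≤ 1} < ∞`. -/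
def MemBVp {n : ℕ} (p : Eu n → ℝ) (Ω : Set (Eu n)) (u : Eu n → ℝ) : Prop :=
  MemLpVar p Ω u ∧
    ∃ g : Eu n → Eu n, IsWeakGrad (Ω \ {x | p x = 1}) u g ∧
      ∃ l : ℝ, 0 < l ∧
        hhlModular p Ω Ω (fun x => u x / l) (fun x => l⁻¹ • g x) ≤ 1

/-- Mollification `u_δ = φ_δ ∗ u` (with `u` extended by zero outside `Ω`),
where `φ_δ(z) = δ^{-n} φ(z/δ)`. -/
def mollify {n : ℕ} (Ω : Set (Eu n)) (u : Eu n → ℝ) (φ : Eu n → ℝ) (δ : ℝ)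
    (x : Eu n) : ℝ :=
  ∫ y in Ω, (δ ^ n)⁻¹ * φ (δ⁻¹ • (x - y)) * u y

/-- `p` is (locally) log-Hölder continuous on `Ω` with constant `c`. -/
def LogHolderOn {n : ℕ} (c : ℝ) (Ω : Set (Eu n)) (p : Eu n → ℝ) : Prop :=
  ∀ x ∈ Ω, ∀ y ∈ Ω, |p x - p y| ≤ c / Real.log (Real.exp 1 + 1 / dist x y)

/-- `p` is globally log-Hölder continuous on `ℝⁿ` with constant `c`. -/
def LogHolderGlobal {n : ℕ} (c : ℝ) (p : Eu n → ℝ) : Prop :=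
  LogHolderOn c Set.univ p ∧
    ∃ pinf : ℝ, 1 ≤ pinf ∧ ∀ x, |p x - pinf| ≤ c / Real.log (Real.exp 1 + ‖x‖)

/-- The variable exponent Sobolev capacity `C_{p(·)}(E)`: infimum of
`∫ |u|^{p(x)} + |∇u|^{p(x)} dx` over `u ∈ W^{1,p(·)}(ℝⁿ)` with `u ≥ 1` on an
open set containing `E`. -/
def sobolevCapacity {n : ℕ} (p : Eu n → ℝ) (E : Set (Eu n)) : ℝ≥0∞ :=
  ⨅ (u : Eu n → ℝ) (g : Eu n → Eu n)
    (_ : MemLpVar p Set.univ u ∧ IsWeakGrad Set.univ u g ∧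
         MemLpVar p Set.univ (fun x => ‖g x‖) ∧
         ∃ U : Set (Eu n), IsOpen U ∧ E ⊆ U ∧ ∀ x ∈ U, 1 ≤ u x),
    vModular p Set.univ u + ∫⁻ x, ENNReal.ofReal (‖g x‖ ^ p x)

/-! ### Elementary modular estimates -/

theorem vModular_scale_up {n : ℕ} {p : Eu n → ℝ} {Ω : Set (Eu n)} (hΩ : IsOpen Ω) {M : ℝ}
    (hp : ∀ x ∈ Ω, 1 ≤ p x ∧ p x ≤ M) (u w : Eu n → ℝ) (c : ℝ) (hc : 1 ≤ c)
    (h : ∀ x ∈ Ω, |w x| ≤ c * |u x|) :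
    vModular p Ω w ≤ ENNReal.ofReal (c ^ M) * vModular p Ω u := by
  unfold vModular
  rw [← lintegral_const_mul' _ _ ENNReal.ofReal_ne_top]
  refine setLIntegral_mono' hΩ.measurableSet (fun x hx => ?_)
  rw [← ENNReal.ofReal_mul (by positivity)]
  refine ENNReal.ofReal_le_ofReal ?_
  obtain ⟨h1, h2⟩ := hp x hx
  calc |w x| ^ p x ≤ (c * |u x|) ^ p x :=
        Real.rpow_le_rpow (abs_nonneg _) (h x hx) (by linarith)
    _ = c ^ p x * |u x| ^ p x := Real.mul_rpow (by linarith) (abs_nonneg _)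
    _ ≤ c ^ M * |u x| ^ p x := by
        gcongr

theorem vModular_scale_down {n : ℕ} {p : Eu n → ℝ} {Ω : Set (Eu n)} (hΩ : IsOpen Ω)
    (hp : ∀ x ∈ Ω, 1 ≤ p x) (u w : Eu n → ℝ) (c : ℝ) (hc0 : 0 ≤ c) (hc : c ≤ 1)
    (h : ∀ x ∈ Ω, |w x| ≤ c * |u x|) :
    vModular p Ω w ≤ ENNReal.ofReal c * vModular p Ω u := by
  unfold vModular
  rw [← lintegral_const_mul' _ _ ENNReal.ofReal_ne_top]
  refine setLIntegral_mono' hΩ.measurableSet (fun x hx => ?_)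
  rw [← ENNReal.ofReal_mul (by positivity)]
  refine ENNReal.ofReal_le_ofReal ?_
  have h1 := hp x hx
  calc |w x| ^ p x ≤ (c * |u x|) ^ p x :=
        Real.rpow_le_rpow (abs_nonneg _) (h x hx) (by linarith)
    _ = c ^ p x * |u x| ^ p x := Real.mul_rpow (by linarith) (abs_nonneg _)
    _ ≤ c ^ (1 : ℝ) * |u x| ^ p x := by
        refine mul_le_mul_of_nonneg_right ?_ (by positivity)
        exact Real.rpow_le_rpow_of_exponent_ge' hc0 hc (by norm_num) h1
    _ = c * |u x| ^ p x := by rw [Real.rpow_one]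

theorem measurable_integrand {n : ℕ} {p : Eu n → ℝ} (hpm : Measurable p) {u : Eu n → ℝ}
    (hu : Measurable u) : Measurable (fun x => ENNReal.ofReal (|u x| ^ p x)) := by
  have : Measurable (fun x => |u x|) := by fun_prop
  exact (this.pow hpm).ennreal_ofReal

theorem vModular_le_of_max {n : ℕ} {p : Eu n → ℝ} {Ω : Set (Eu n)} (hΩ : IsOpen Ω)
    (hpm : Measurable p) (hp : ∀ x ∈ Ω, 1 ≤ p x) {u v w : Eu n → ℝ} (hu : Measurable u)
    (h : ∀ x ∈ Ω, |w x| ≤ max |u x| |v x|) :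
    vModular p Ω w ≤ vModular p Ω u + vModular p Ω v := by
  unfold vModular
  rw [← lintegral_add_left (measurable_integrand hpm hu)]
  refine setLIntegral_mono' hΩ.measurableSet (fun x hx => ?_)
  rw [← ENNReal.ofReal_add (by positivity) (by positivity)]
  refine ENNReal.ofReal_le_ofReal ?_
  have h1 := hp x hx
  have h2 := Real.rpow_le_rpow (abs_nonneg _) (h x hx) (by linarith : 0 ≤ p x)
  have h3 : 0 ≤ |u x| ^ p x := by positivity
  have h4 : 0 ≤ |v x| ^ p x := by positivity
  rcases max_choice |u x| |v x| with e | e <;> rw [e] at h2 <;> linarith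

theorem vModular_add_le {n : ℕ} {p : Eu n → ℝ} {Ω : Set (Eu n)} (hΩ : IsOpen Ω)
    (hpm : Measurable p) {M : ℝ} (hp : ∀ x ∈ Ω, 1 ≤ p x ∧ p x ≤ M) {u v w : Eu n → ℝ}
    (hu : Measurable u) (h : ∀ x ∈ Ω, |w x| ≤ |u x| + |v x|) :
    vModular p Ω w ≤ ENNReal.ofReal (2 ^ M) * (vModular p Ω u + vModular p Ω v) := by
  refine (vModular_scale_up hΩ hp (fun x => max |u x| |v x|) w 2 (by norm_num) ?_).trans ?_
  · intro x hx
    have h1 := h x hx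
    have h2 := le_max_left |u x| |v x|
    have h3 := le_max_right |u x| |v x|
    rw [abs_of_nonneg ((abs_nonneg _).trans h2)]
    linarith
  · gcongr
    refine vModular_le_of_max hΩ hpm (fun x hx => (hp x hx).1) hu (fun x hx => ?_)
    rw [abs_of_nonneg ((abs_nonneg _).trans (le_max_left |u x| |v x|))]

theorem memLpVar_iff {n : ℕ} {p : Eu n → ℝ} {Ω : Set (Eu n)} (hΩ : IsOpen Ω) {M : ℝ}
    (hp : ∀ x ∈ Ω, 1 ≤ p x ∧ p x ≤ M) (u : Eu n → ℝ) :
    MemLpVar p Ω u ↔ Measurable u ∧ vModular p Ω u < ⊤ := by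
  constructor
  · rintro ⟨hu, l, hl, h⟩
    refine ⟨hu, ?_⟩
    refine (vModular_scale_up hΩ hp (fun x => u x / l) u (max l 1) (le_max_right _ _) ?_).trans_lt
      (ENNReal.mul_lt_top ENNReal.ofReal_lt_top h)
    intro x _
    rw [abs_div, abs_of_pos hl]
    calc |u x| = l * (|u x| / l) := by field_simp
      _ ≤ _ := by gcongr; exact le_max_left _ _
  · rintro ⟨hu, h⟩
    exact ⟨hu, 1, one_pos, by simpa using h⟩

theorem luxNorm_nonneg {n : ℕ} (p : Eu n → ℝ) (Ω : Set (Eu n)) (u : Eu n → ℝ) :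
    0 ≤ luxNorm p Ω u := Real.sInf_nonneg (fun _ hl => hl.1.le)

/-- Norm smallness implies modular smallness. -/
theorem vModular_le_of_luxNorm_lt {n : ℕ} {p : Eu n → ℝ} {Ω : Set (Eu n)} (hΩ : IsOpen Ω)
    (hp : ∀ x ∈ Ω, 1 ≤ p x) {w : Eu n → ℝ} (hw : vModular p Ω w < ⊤) {δ : ℝ} (hδ : δ ≤ 1)
    (h : luxNorm p Ω w < δ) : vModular p Ω w ≤ ENNReal.ofReal δ := by
  have hne : {l : ℝ | 0 < l ∧ vModular p Ω (fun x => w x / l) ≤ 1}.Nonempty := by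
    set a := (vModular p Ω w).toReal with ha
    have ha0 : 0 ≤ a := ENNReal.toReal_nonneg
    refine ⟨a + 1, by positivity, ?_⟩
    refine (vModular_scale_down hΩ hp w _ (a + 1)⁻¹ (by positivity)
      (inv_le_one_of_one_le₀ (by linarith)) ?_).trans ?_
    · intro x _
      rw [abs_div, abs_of_pos (by positivity : 0 < a + 1), div_eq_inv_mul]
    · rw [← ENNReal.ofReal_toReal hw.ne, ← ha, ← ENNReal.ofReal_mul (by positivity),
        ENNReal.ofReal_le_one, inv_mul_le_iff₀ (by positivity)]
      linarith
  obtain ⟨l, ⟨hl0, hl⟩, hlδ⟩ := exists_lt_of_csInf_lt hne h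
  refine (vModular_scale_down hΩ hp (fun x => w x / l) w l hl0.le (by linarith) ?_).trans ?_
  · intro x _
    rw [abs_div, abs_of_pos hl0]
    exact le_of_eq (by field_simp)
  · calc _ ≤ ENNReal.ofReal l * 1 := by gcongr
      _ ≤ _ := by rw [mul_one]; exact ENNReal.ofReal_le_ofReal hlδ.le

/-- Modular convergence implies norm convergence. -/
theorem lpTendsto_of_modular {n : ℕ} {p : Eu n → ℝ} {Ω : Set (Eu n)} (hΩ : IsOpen Ω) {M : ℝ}
    (hp : ∀ x ∈ Ω, 1 ≤ p x ∧ p x ≤ M) {v : ℕ → Eu n → ℝ} {u : Eu n → ℝ}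
    (h : Tendsto (fun i => vModular p Ω (fun x => v i x - u x)) atTop (𝓝 0)) :
    LpTendsto p Ω v u := by
  unfold LpTendsto
  rw [Metric.tendsto_atTop]
  intro ε hε
  set l := min (ε / 2) 1 with hl
  have hl0 : 0 < l := by positivity
  have hlε : l < ε := (min_le_left _ _).trans_lt (by linarith)
  have hpos : (0 : ℝ≥0∞) < ENNReal.ofReal (l ^ M) := by
    rw [ENNReal.ofReal_pos]; positivity
  obtain ⟨N, hN⟩ := eventually_atTop.1 (h.eventually (gt_mem_nhds hpos))
  refine ⟨N, fun i hi => ?_⟩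
  rw [Real.dist_0_eq_abs, abs_of_nonneg (luxNorm_nonneg _ _ _)]
  refine lt_of_le_of_lt (csInf_le ⟨0, fun _ hl => hl.1.le⟩ ⟨hl0, ?_⟩) hlε
  refine (vModular_scale_up hΩ hp (fun x => v i x - u x) _ l⁻¹
    ((one_le_inv₀ hl0).2 (min_le_right _ _)) ?_).trans ?_
  · intro x _
    rw [abs_div, abs_of_pos hl0, div_eq_inv_mul]
  · calc _ ≤ ENNReal.ofReal (l⁻¹ ^ M) * ENNReal.ofReal (l ^ M) := by
          gcongr
          exact (hN i hi).le
      _ = 1 := by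
          rw [← ENNReal.ofReal_mul (by positivity), Real.inv_rpow hl0.le,
            inv_mul_cancel₀ (by positivity), ENNReal.ofReal_one]

/-! ### Characterisation of the relaxed modular -/

theorem vModular_sub_lt_top {n : ℕ} {p : Eu n → ℝ} {Ω : Set (Eu n)} (hΩ : IsOpen Ω)
    (hpm : Measurable p) {M : ℝ} (hp : ∀ x ∈ Ω, 1 ≤ p x ∧ p x ≤ M) {u v : Eu n → ℝ}
    (hu : MemLpVar p Ω u) (hv : MemLpVar p Ω v) :
    vModular p Ω (fun x => v x - u x) < ⊤ := by
  rw [memLpVar_iff hΩ hp] at hu hv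
  refine (vModular_add_le hΩ hpm hp hv.1 (fun x _ => abs_sub _ _)).trans_lt ?_
  exact ENNReal.mul_lt_top ENNReal.ofReal_lt_top (ENNReal.add_lt_top.2 ⟨hv.2, hu.2⟩)

theorem bvModular_approx {n : ℕ} {p : Eu n → ℝ} {Ω : Set (Eu n)} (hΩ : IsOpen Ω)
    (hpm : Measurable p) {M : ℝ} (hp : ∀ x ∈ Ω, 1 ≤ p x ∧ p x ≤ M) {u : Eu n → ℝ}
    (hu : MemLpVar p Ω u) {c : ℝ≥0∞} (hc : bvModular p Ω u < c) {ε : ℝ≥0∞} (hε : ε ≠ 0) :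
    ∃ f, LocLipOn Ω f ∧ MemLpVar p Ω f ∧ vModular p Ω (fun x => f x - u x) ≤ ε ∧
      gradModular p Ω f ≤ c := by
  unfold bvModular at hc
  simp only [iInf_lt_iff] at hc
  obtain ⟨v, ⟨hv, ht⟩, hlt⟩ := hc
  have hfr := frequently_lt_of_liminf_lt (by isBoundedDefault) hlt
  obtain ⟨δ, hδ0, hδ1, hδε⟩ : ∃ δ : ℝ, 0 < δ ∧ δ ≤ 1 ∧ ENNReal.ofReal δ ≤ ε := by
    refine ⟨(min ε 1).toReal, ?_, ?_, ?_⟩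
    · refine ENNReal.toReal_pos (by simp [hε]) (ne_top_of_le_ne_top ENNReal.one_ne_top (min_le_right _ _))
    · exact ENNReal.toReal_le_of_le_ofReal zero_le_one (by simp)
    · rw [ENNReal.ofReal_toReal (ne_top_of_le_ne_top ENNReal.one_ne_top (min_le_right _ _))]
      exact min_le_left _ _
  obtain ⟨i, hi1, hi2⟩ := (hfr.and_eventually (ht.eventually (gt_mem_nhds hδ0))).exists
  refine ⟨v i, (hv i).1, (hv i).2, ?_, hi1.le⟩
  exact (vModular_le_of_luxNorm_lt hΩ (fun x hx => (hp x hx).1)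
    (vModular_sub_lt_top hΩ hpm hp hu (hv i).2) hδ1 hi2).trans hδε

theorem bvModular_le_liminf {n : ℕ} {p : Eu n → ℝ} {Ω : Set (Eu n)} (hΩ : IsOpen Ω)
    {M : ℝ} (hp : ∀ x ∈ Ω, 1 ≤ p x ∧ p x ≤ M) {u : Eu n → ℝ} {f : ℕ → Eu n → ℝ}
    (hf : ∀ i, LocLipOn Ω (f i) ∧ MemLpVar p Ω (f i))
    (h : Tendsto (fun i => vModular p Ω (fun x => f i x - u x)) atTop (𝓝 0)) :
    bvModular p Ω u ≤ liminf (fun i => gradModular p Ω (f i)) atTop :=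
  iInf₂_le f ⟨hf, lpTendsto_of_modular hΩ hp h⟩

theorem tendsto_inv_nat_succ : Tendsto (fun i : ℕ => ((i : ℝ≥0∞) + 1)⁻¹) atTop (𝓝 0) := by
  have := (tendsto_add_atTop_iff_nat 1).2 ENNReal.tendsto_inv_nat_nhds_zero
  simpa using this

theorem inv_nat_succ_ne_zero (i : ℕ) : ((i : ℝ≥0∞) + 1)⁻¹ ≠ 0 := by
  rw [ENNReal.inv_ne_zero]; exact ENNReal.add_ne_top.2 ⟨ENNReal.natCast_ne_top i, ENNReal.one_ne_top⟩

/-- A recovery sequence. -/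
theorem bvModular_seq {n : ℕ} {p : Eu n → ℝ} {Ω : Set (Eu n)} (hΩ : IsOpen Ω)
    (hpm : Measurable p) {M : ℝ} (hp : ∀ x ∈ Ω, 1 ≤ p x ∧ p x ≤ M) {u : Eu n → ℝ}
    (hu : MemLpVar p Ω u) (hc : bvModular p Ω u ≠ ⊤) :
    ∃ f : ℕ → Eu n → ℝ, (∀ i, LocLipOn Ω (f i) ∧ MemLpVar p Ω (f i)) ∧
      (∀ i : ℕ, vModular p Ω (fun x => f i x - u x) ≤ ((i : ℝ≥0∞) + 1)⁻¹) ∧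
      (∀ i : ℕ, gradModular p Ω (f i) ≤ bvModular p Ω u + ((i : ℝ≥0∞) + 1)⁻¹) := by
  choose f h1 h2 h3 h4 using fun i : ℕ => bvModular_approx hΩ hpm hp hu
    (ENNReal.lt_add_right hc (inv_nat_succ_ne_zero i)) (inv_nat_succ_ne_zero i)
  exact ⟨f, fun i => ⟨h1 i, h2 i⟩, h3, h4⟩

theorem liminf_add_liminf_le {a b c : ℕ → ℝ≥0∞} {C : ℝ≥0∞} (hc : Tendsto c atTop (𝓝 C))
    (h : ∀ i, a i + b i ≤ c i) : liminf a atTop + liminf b atTop ≤ C := by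
  rw [liminf_eq_iSup_iInf_of_nat, liminf_eq_iSup_iInf_of_nat, ENNReal.iSup_add_iSup_of_monotone]
  · refine iSup_le fun N => ge_of_tendsto hc ?_
    filter_upwards [eventually_ge_atTop N] with i hi
    exact (add_le_add (iInf₂_le i hi) (iInf₂_le i hi)).trans (h i)
  · intro i j hij
    exact le_iInf₂ fun k hk => iInf₂_le k (le_trans hij hk)
  · intro i j hij
    exact le_iInf₂ fun k hk => iInf₂_le k (le_trans hij hk)

/-- Lower semicontinuity of the relaxed modular. -/
theorem bvModular_lsc {n : ℕ} {p : Eu n → ℝ} {Ω : Set (Eu n)} (hΩ : IsOpen Ω)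
    (hpm : Measurable p) {M : ℝ} (hp : ∀ x ∈ Ω, 1 ≤ p x ∧ p x ≤ M) {u : Eu n → ℝ}
    {v : ℕ → Eu n → ℝ} (hv : ∀ i, MemLpVar p Ω (v i)) (hb : ∀ i, bvModular p Ω (v i) ≠ ⊤)
    (h : Tendsto (fun i => vModular p Ω (fun x => v i x - u x)) atTop (𝓝 0)) :
    bvModular p Ω u ≤ liminf (fun i => bvModular p Ω (v i)) atTop := by
  choose f h1 h2 h3 h4 using fun i : ℕ => bvModular_approx hΩ hpm hp (hv i)
    (ENNReal.lt_add_right (hb i) (inv_nat_succ_ne_zero i)) (inv_nat_succ_ne_zero i)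
  rw [← ENNReal.liminf_add_of_right_tendsto_zero tendsto_inv_nat_succ]
  refine (bvModular_le_liminf hΩ hp (fun i => ⟨h1 i, h2 i⟩) ?_).trans
    (liminf_le_liminf (Eventually.of_forall h4))
  have hT : Tendsto (fun i : ℕ => ENNReal.ofReal (2 ^ M) *
      (((i : ℝ≥0∞) + 1)⁻¹ + vModular p Ω (fun x => v i x - u x))) atTop (𝓝 0) := by
    have := ENNReal.Tendsto.const_mul (a := ENNReal.ofReal (2 ^ M))
      (tendsto_inv_nat_succ.add h) (Or.inr ENNReal.ofReal_ne_top)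
    simpa using this
  refine tendsto_of_tendsto_of_tendsto_of_le_of_le tendsto_const_nhds hT (fun _ => zero_le) ?_
  intro i
  refine (vModular_add_le hΩ hpm hp (u := fun x => f i x - v i x) (v := fun x => v i x - u x)
    ((h2 i).1.sub (hv i).1) (fun x _ => ?_)).trans ?_
  · exact abs_sub_le _ _ _
  · exact mul_le_mul' le_rfl (add_le_add (h3 i) le_rfl)

/-! ### Submodularity -/

theorem LocLipOn.ae_differentiableAt {n : ℕ} {Ω : Set (Eu n)} (hΩ : IsOpen Ω) {f : Eu n → ℝ}
    (hf : LocLipOn Ω f) : ∀ᵐ x ∂(volume.restrict Ω), DifferentiableAt ℝ f x := by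
  rw [ae_restrict_iff' hΩ.measurableSet, ae_iff]
  refine measure_null_of_locally_null _ (fun x hx => ?_)
  have hxΩ : x ∈ Ω := by
    by_contra hcon
    exact hx (fun h => absurd h hcon)
  obtain ⟨K, t, ht, hL⟩ := hf x hxΩ
  rw [hΩ.nhdsWithin_eq hxΩ] at ht
  refine ⟨{y | ¬ (y ∈ Ω → DifferentiableAt ℝ f y)} ∩ interior t, ?_, ?_⟩
  · exact inter_mem self_mem_nhdsWithin
      (mem_nhdsWithin_of_mem_nhds (interior_mem_nhds.2 ht))
  · have := hL.ae_differentiableWithinAt_of_mem (μ := (volume : Measure (Eu n)))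
    rw [ae_iff] at this
    refine measure_mono_null ?_ this
    rintro y ⟨hy1, hy2⟩ hcon
    have hd := (hcon (interior_subset hy2)).differentiableAt (mem_interior_iff_mem_nhds.1 hy2)
    exact hy1 (fun _ => hd)

theorem LocLipOn.of_max_bound {n : ℕ} {Ω : Set (Eu n)} {f g w : Eu n → ℝ}
    (hf : LocLipOn Ω f) (hg : LocLipOn Ω g)
    (h : ∀ x y, |w x - w y| ≤ max |f x - f y| |g x - g y|) : LocLipOn Ω w := by
  intro x hx
  obtain ⟨K, t, ht, hK⟩ := hf x hx
  obtain ⟨L, s, hs, hL⟩ := hg x hx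
  refine ⟨max K L, t ∩ s, inter_mem ht hs, LipschitzOnWith.of_dist_le_mul ?_⟩
  rintro a ⟨ha1, ha2⟩ b ⟨hb1, hb2⟩
  have e1 := hK.dist_le_mul a ha1 b hb1
  have e2 := hL.dist_le_mul a ha2 b hb2
  rw [Real.dist_eq] at e1 e2 ⊢
  refine (h a b).trans (max_le (e1.trans ?_) (e2.trans ?_))
  · gcongr; exact le_max_left _ _
  · gcongr; exact le_max_right _ _

theorem fderiv_eq_of_ge {n : ℕ} {f g : Eu n → ℝ} {x : Eu n} (hf : DifferentiableAt ℝ f x)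
    (hg : DifferentiableAt ℝ g x) (hx : f x = g x) (h : ∀ y, f y ≤ g y) :
    fderiv ℝ f x = fderiv ℝ g x := by
  have hm : IsLocalMin (fun y => g y - f y) x := by
    refine Eventually.of_forall (fun y => ?_)
    have := h y
    simp only [hx]
    linarith
  have h0 := hm.fderiv_eq_zero
  have h1 : fderiv ℝ (fun y => g y - f y) x = fderiv ℝ g x - fderiv ℝ f x :=
    fderiv_fun_sub hg hf
  rw [h1, sub_eq_zero] at h0
  exact h0.symm

theorem LocLipOn.continuousAt {n : ℕ} {Ω : Set (Eu n)} (hΩ : IsOpen Ω) {f : Eu n → ℝ}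
    (hf : LocLipOn Ω f) {x : Eu n} (hx : x ∈ Ω) : ContinuousAt f x := by
  obtain ⟨K, t, ht, hK⟩ := hf x hx
  rw [hΩ.nhdsWithin_eq hx] at ht
  exact hK.continuousOn.continuousAt ht

theorem measurable_gradIntegrand {n : ℕ} {p : Eu n → ℝ} (hpm : Measurable p) (u : Eu n → ℝ) :
    Measurable (fun x => ENNReal.ofReal (‖fderiv ℝ u x‖ ^ p x)) :=
  ((measurable_fderiv ℝ u).norm.pow hpm).ennreal_ofReal

theorem gradModular_max_add_min {n : ℕ} {p : Eu n → ℝ} {Ω : Set (Eu n)} (hΩ : IsOpen Ω)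
    (hpm : Measurable p) {f g : Eu n → ℝ} (hf : LocLipOn Ω f) (hg : LocLipOn Ω g) :
    gradModular p Ω (fun x => max (f x) (g x)) + gradModular p Ω (fun x => min (f x) (g x)) =
      gradModular p Ω f + gradModular p Ω g := by
  have hmax : LocLipOn Ω (fun x => max (f x) (g x)) :=
    hf.of_max_bound hg (fun x y => abs_max_sub_max_le_max _ _ _ _)
  have hmin : LocLipOn Ω (fun x => min (f x) (g x)) :=
    hf.of_max_bound hg (fun x y => abs_min_sub_min_le_max _ _ _ _)
  unfold gradModular
  rw [← lintegral_add_left (measurable_gradIntegrand hpm _),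
    ← lintegral_add_left (measurable_gradIntegrand hpm _)]
  refine lintegral_congr_ae ?_
  filter_upwards [hf.ae_differentiableAt hΩ, hg.ae_differentiableAt hΩ,
    hmax.ae_differentiableAt hΩ, hmin.ae_differentiableAt hΩ,
    ae_restrict_mem hΩ.measurableSet] with x d1 d2 d3 d4 hx
  rcases lt_trichotomy (f x) (g x) with h | h | h
  · have hev : ∀ᶠ y in 𝓝 x, f y < g y :=
      (hf.continuousAt hΩ hx).eventually_lt (hg.continuousAt hΩ hx) h
    have e1 : fderiv ℝ (fun x => max (f x) (g x)) x = fderiv ℝ g x :=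
      Filter.EventuallyEq.fderiv_eq (hev.mono fun y hy => max_eq_right hy.le)
    have e2 : fderiv ℝ (fun x => min (f x) (g x)) x = fderiv ℝ f x :=
      Filter.EventuallyEq.fderiv_eq (hev.mono fun y hy => min_eq_left hy.le)
    rw [e1, e2, add_comm]
  · have e1 : fderiv ℝ f x = fderiv ℝ (fun x => max (f x) (g x)) x :=
      fderiv_eq_of_ge d1 d3 (by simp [h]) (fun y => le_max_left _ _)
    have e2 : fderiv ℝ g x = fderiv ℝ (fun x => max (f x) (g x)) x :=
      fderiv_eq_of_ge d2 d3 (by simp [h]) (fun y => le_max_right _ _)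
    have e3 : fderiv ℝ (fun x => min (f x) (g x)) x = fderiv ℝ f x :=
      fderiv_eq_of_ge d4 d1 (by simp [h]) (fun y => min_le_left _ _)
    rw [e3, e2, e1]
  · have hev : ∀ᶠ y in 𝓝 x, g y < f y :=
      (hg.continuousAt hΩ hx).eventually_lt (hf.continuousAt hΩ hx) h
    have e1 : fderiv ℝ (fun x => max (f x) (g x)) x = fderiv ℝ f x :=
      Filter.EventuallyEq.fderiv_eq (hev.mono fun y hy => max_eq_left hy.le)
    have e2 : fderiv ℝ (fun x => min (f x) (g x)) x = fderiv ℝ g x :=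
      Filter.EventuallyEq.fderiv_eq (hev.mono fun y hy => min_eq_right hy.le)
    rw [e1, e2]

theorem vModular_max_add_min {n : ℕ} {p : Eu n → ℝ} {Ω : Set (Eu n)}
    (hpm : Measurable p) {f g : Eu n → ℝ} (hf : Measurable f) (hg : Measurable g) :
    vModular p Ω (fun x => max (f x) (g x)) + vModular p Ω (fun x => min (f x) (g x)) =
      vModular p Ω f + vModular p Ω g := by
  unfold vModular
  rw [← lintegral_add_left (measurable_integrand hpm (hf.max hg)),
    ← lintegral_add_left (measurable_integrand hpm hf)]
  refine lintegral_congr fun x => ?_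
  beta_reduce
  rcases le_total (f x) (g x) with h | h
  · rw [max_eq_right h, min_eq_left h, add_comm]
  · rw [max_eq_left h, min_eq_right h]

theorem MemLpVar.max {n : ℕ} {p : Eu n → ℝ} {Ω : Set (Eu n)} (hΩ : IsOpen Ω)
    (hpm : Measurable p) {M : ℝ} (hp : ∀ x ∈ Ω, 1 ≤ p x ∧ p x ≤ M) {f g : Eu n → ℝ}
    (hf : MemLpVar p Ω f) (hg : MemLpVar p Ω g) :
    MemLpVar p Ω (fun x => max (f x) (g x)) := by
  rw [memLpVar_iff hΩ hp] at *
  refine ⟨hf.1.max hg.1, lt_of_le_of_lt ?_ (ENNReal.add_lt_top.2 ⟨hf.2, hg.2⟩)⟩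
  rw [← vModular_max_add_min hpm hf.1 hg.1]
  exact le_self_add

theorem MemLpVar.min {n : ℕ} {p : Eu n → ℝ} {Ω : Set (Eu n)} (hΩ : IsOpen Ω)
    (hpm : Measurable p) {M : ℝ} (hp : ∀ x ∈ Ω, 1 ≤ p x ∧ p x ≤ M) {f g : Eu n → ℝ}
    (hf : MemLpVar p Ω f) (hg : MemLpVar p Ω g) :
    MemLpVar p Ω (fun x => min (f x) (g x)) := by
  rw [memLpVar_iff hΩ hp] at *
  refine ⟨hf.1.min hg.1, lt_of_le_of_lt ?_ (ENNReal.add_lt_top.2 ⟨hf.2, hg.2⟩)⟩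
  rw [← vModular_max_add_min hpm hf.1 hg.1]
  exact le_add_self

theorem bvModular_max_add_min {n : ℕ} {p : Eu n → ℝ} {Ω : Set (Eu n)} (hΩ : IsOpen Ω)
    (hpm : Measurable p) {M : ℝ} (hp : ∀ x ∈ Ω, 1 ≤ p x ∧ p x ≤ M) {u v : Eu n → ℝ}
    (hu : MemLpVar p Ω u) (hv : MemLpVar p Ω v)
    (hbu : bvModular p Ω u ≠ ⊤) (hbv : bvModular p Ω v ≠ ⊤) :
    bvModular p Ω (fun x => max (u x) (v x)) + bvModular p Ω (fun x => min (u x) (v x)) ≤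
      bvModular p Ω u + bvModular p Ω v := by
  obtain ⟨f, hf1, hf2, hf3⟩ := bvModular_seq hΩ hpm hp hu hbu
  obtain ⟨g, hg1, hg2, hg3⟩ := bvModular_seq hΩ hpm hp hv hbv
  have hp' : ∀ x ∈ Ω, 1 ≤ p x := fun x hx => (hp x hx).1
  have h0 : Tendsto (fun i : ℕ => ((i : ℝ≥0∞) + 1)⁻¹ + ((i : ℝ≥0∞) + 1)⁻¹) atTop (𝓝 0) := by
    simpa using tendsto_inv_nat_succ.add tendsto_inv_nat_succ
  have key : ∀ w : ℕ → Eu n → ℝ, ∀ z : Eu n → ℝ,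
      (∀ i x, |w i x - z x| ≤ max |f i x - u x| |g i x - v x|) →
      Tendsto (fun i => vModular p Ω (fun x => w i x - z x)) atTop (𝓝 0) := by
    intro w z hwz
    refine tendsto_of_tendsto_of_tendsto_of_le_of_le tendsto_const_nhds h0 (fun _ => zero_le) ?_
    intro i
    exact (vModular_le_of_max hΩ hpm hp' (u := fun x => f i x - u x) (v := fun x => g i x - v x)
      ((hf1 i).2.1.sub hu.1) (fun x _ => hwz i x)).trans (add_le_add (hf2 i) (hg2 i))
  have hA := bvModular_le_liminf hΩ hp (u := fun x => max (u x) (v x))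
    (f := fun i x => max (f i x) (g i x))
    (fun i => ⟨(hf1 i).1.of_max_bound (hg1 i).1 (fun x y => abs_max_sub_max_le_max _ _ _ _),
      (hf1 i).2.max hΩ hpm hp (hg1 i).2⟩)
    (key _ _ fun i x => abs_max_sub_max_le_max _ _ _ _)
  have hB := bvModular_le_liminf hΩ hp (u := fun x => min (u x) (v x))
    (f := fun i x => min (f i x) (g i x))
    (fun i => ⟨(hf1 i).1.of_max_bound (hg1 i).1 (fun x y => abs_min_sub_min_le_max _ _ _ _),
      (hf1 i).2.min hΩ hpm hp (hg1 i).2⟩)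
    (key _ _ fun i x => abs_min_sub_min_le_max _ _ _ _)
  refine (add_le_add hA hB).trans (liminf_add_liminf_le
    (c := fun i : ℕ => (bvModular p Ω u + ((i : ℝ≥0∞) + 1)⁻¹) +
      (bvModular p Ω v + ((i : ℝ≥0∞) + 1)⁻¹)) ?_ ?_)
  · have := (tendsto_inv_nat_succ.const_add (bvModular p Ω u)).add
      (tendsto_inv_nat_succ.const_add (bvModular p Ω v))
    simpa using this
  · intro i
    rw [gradModular_max_add_min hΩ hpm (hf1 i).1 (hg1 i).1]
    exact add_le_add (hf3 i) (hg3 i)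

/-! ### The capacity -/

theorem bvCapacity_le {n : ℕ} {p : Eu n → ℝ} {Ω E : Set (Eu n)} {u : Eu n → ℝ}
    (hu : u ∈ admissibleBV p Ω E) : bvCapacity p Ω E ≤ vModular p Ω u + bvModular p Ω u :=
  iInf₂_le u hu

theorem admissibleBV_anti {n : ℕ} {p : Eu n → ℝ} {Ω E F : Set (Eu n)} (h : E ⊆ F)
    {u : Eu n → ℝ} (hu : u ∈ admissibleBV p Ω F) : u ∈ admissibleBV p Ω E := by
  obtain ⟨h1, h2, U, hU, hFU, h3⟩ := hu
  exact ⟨h1, h2, U, hU, h.trans hFU, h3⟩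

theorem bvCapacity_mono {n : ℕ} {p : Eu n → ℝ} {Ω E F : Set (Eu n)} (h : E ⊆ F) :
    bvCapacity p Ω E ≤ bvCapacity p Ω F :=
  le_iInf₂ fun _ hu => bvCapacity_le (admissibleBV_anti h hu)

/-- Outer regularity in a form usable for everything below. -/
theorem bvCapacity_outer {n : ℕ} {p : Eu n → ℝ} {Ω E : Set (Eu n)} {c : ℝ≥0∞}
    (h : bvCapacity p Ω E < c) :
    ∃ U, IsOpen U ∧ E ⊆ U ∧ bvCapacity p Ω U < c := by
  unfold bvCapacity at h
  simp only [iInf_lt_iff] at h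
  obtain ⟨u, ⟨h1, h2, U, hU, hEU, h3⟩, hlt⟩ := h
  exact ⟨U, hU, hEU, (bvCapacity_le ⟨h1, h2, U, hU, Subset.rfl, h3⟩).trans_lt hlt⟩

theorem bvCapacity_approx {n : ℕ} {p : Eu n → ℝ} {Ω E : Set (Eu n)} {c : ℝ≥0∞}
    (h : bvCapacity p Ω E < c) :
    ∃ u ∈ admissibleBV p Ω E, vModular p Ω u + bvModular p Ω u ≤ c := by
  unfold bvCapacity at h
  simp only [iInf_lt_iff] at h
  obtain ⟨u, hu, hlt⟩ := h
  exact ⟨u, hu, hlt.le⟩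

theorem admissible_max_min {n : ℕ} {p : Eu n → ℝ} {Ω : Set (Eu n)} (hΩ : IsOpen Ω)
    (hpm : Measurable p) {M : ℝ} (hp : ∀ x ∈ Ω, 1 ≤ p x ∧ p x ≤ M) {u v : Eu n → ℝ}
    {E F : Set (Eu n)} (hEF : E ⊆ F)
    (hu : u ∈ admissibleBV p Ω E) (hv : v ∈ admissibleBV p Ω F) :
    (fun x => max (u x) (v x)) ∈ admissibleBV p Ω F ∧
    (vModular p Ω (fun x => max (u x) (v x)) + bvModular p Ω (fun x => max (u x) (v x))) +
      bvCapacity p Ω E ≤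
      (vModular p Ω u + bvModular p Ω u) + (vModular p Ω v + bvModular p Ω v) := by
  obtain ⟨⟨u1, u2⟩, u3, U, hU, hEU, u4⟩ := hu
  obtain ⟨⟨v1, v2⟩, v3, V, hV, hFV, v4⟩ := hv
  have hsum := bvModular_max_add_min hΩ hpm hp u1 v1 u2.ne v2.ne
  have hfin := ENNReal.add_lt_top.1 (hsum.trans_lt (ENNReal.add_lt_top.2 ⟨u2, v2⟩))
  refine ⟨⟨⟨u1.max hΩ hpm hp v1, hfin.1⟩, ?_, V, hV, hFV, ?_⟩, ?_⟩
  · intro x hx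
    exact ⟨le_max_of_le_left (u3 x hx).1, max_le (u3 x hx).2 (v3 x hx).2⟩
  · intro x hx
    simp only [v4 x hx]
    exact max_eq_right (u3 x hx.2).2
  · have hmin : (fun x => min (u x) (v x)) ∈ admissibleBV p Ω E := by
      refine ⟨⟨u1.min hΩ hpm hp v1, hfin.2⟩, ?_, U ∩ V, hU.inter hV,
        subset_inter hEU (hEF.trans hFV), ?_⟩
      · intro x hx
        exact ⟨le_min (u3 x hx).1 (v3 x hx).1, min_le_of_left_le (u3 x hx).2⟩
      · intro x hx
        simp only [v4 x ⟨hx.1.2, hx.2⟩, u4 x ⟨hx.1.1, hx.2⟩, min_self]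
    have hm := vModular_max_add_min (Ω := Ω) hpm u1.1 v1.1
    calc _ ≤ (vModular p Ω (fun x => max (u x) (v x)) + bvModular p Ω (fun x => max (u x) (v x))) +
          (vModular p Ω (fun x => min (u x) (v x)) + bvModular p Ω (fun x => min (u x) (v x))) := by
          gcongr
          exact bvCapacity_le hmin
      _ = (vModular p Ω (fun x => max (u x) (v x)) + vModular p Ω (fun x => min (u x) (v x))) +
          (bvModular p Ω (fun x => max (u x) (v x)) + bvModular p Ω (fun x => min (u x) (v x))) := by
          ring
      _ ≤ (vModular p Ω u + vModular p Ω v) + (bvModular p Ω u + bvModular p Ω v) := by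
          rw [hm]; gcongr
      _ = _ := by ring

theorem bvCapacity_iUnion {n : ℕ} {p : Eu n → ℝ} {Ω : Set (Eu n)} (hΩ : IsOpen Ω)
    (hpm : Measurable p) {M : ℝ} (hp : ∀ x ∈ Ω, 1 ≤ p x ∧ p x ≤ M)
    {E : ℕ → Set (Eu n)} (hE : Monotone E) :
    bvCapacity p Ω (⋃ i, E i) = ⨆ i, bvCapacity p Ω (E i) := by
  refine le_antisymm ?_ (iSup_le fun i => bvCapacity_mono (subset_iUnion E i))
  set S := ⨆ i, bvCapacity p Ω (E i) with hS
  by_cases hST : S = ⊤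
  · rw [hST]; exact le_top
  have hle : ∀ i, bvCapacity p Ω (E i) ≤ S := le_iSup (fun i => bvCapacity p Ω (E i))
  have hfin : ∀ i, bvCapacity p Ω (E i) ≠ ⊤ := fun i => ne_top_of_le_ne_top hST (hle i)
  refine ENNReal.le_of_forall_pos_le_add (fun ε hε _ => ?_)
  obtain ⟨δ, hδ0, hδ⟩ := ENNReal.exists_pos_sum_of_countable' (ENNReal.coe_pos.2 hε).ne' ℕ
  choose u hu hu' using fun i => bvCapacity_approx
    (ENNReal.lt_add_right (hfin i) (hδ0 i).ne')
  let v : ℕ → Eu n → ℝ := fun k => Nat.rec (u 0) (fun k w x => max (w x) (u (k + 1) x)) k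
  have hv1 : ∀ k, v (k + 1) = fun x => max (v k x) (u (k + 1) x) := fun k => rfl
  have hv : ∀ k, v k ∈ admissibleBV p Ω (E k) ∧ vModular p Ω (v k) + bvModular p Ω (v k) ≤
      bvCapacity p Ω (E k) + ∑ i ∈ Finset.range (k + 1), δ i := by
    intro k
    induction k with
    | zero => 
      have hz : v 0 = u 0 := rfl
      rw [hz]
      exact ⟨hu 0, by simpa using hu' 0⟩
    | succ k ih =>
      obtain ⟨h1, h2⟩ := admissible_max_min hΩ hpm hp (hE (Nat.le_succ k)) ih.1 (hu (k + 1))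
      rw [hv1]
      refine ⟨h1, ?_⟩
      have h3 := h2.trans (add_le_add ih.2 (hu' (k + 1)))
      rw [← ENNReal.add_le_add_iff_right (hfin k)]
      refine h3.trans (le_of_eq ?_)
      rw [Finset.sum_range_succ _ (k + 1)]
      ring
  have hF : ∀ k, vModular p Ω (v k) + bvModular p Ω (v k) ≤ S + ε := fun k =>
    (hv k).2.trans (add_le_add (hle k) ((ENNReal.sum_le_tsum _).trans hδ.le))
  have hmono : ∀ x, Monotone (fun k => v k x) := fun x =>
    monotone_nat_of_le_succ (fun k => by rw [hv1]; exact le_max_left _ _)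
  let w : Eu n → ℝ := fun x => ⨆ k, v k x
  have hbdd : ∀ x ∈ Ω, BddAbove (range fun k => v k x) := by
    intro x hx
    refine ⟨1, ?_⟩
    rintro _ ⟨k, rfl⟩
    exact ((hv k).1.2.1 x hx).2
  have hw1 : ∀ x ∈ Ω, w x ≤ 1 := fun x hx => ciSup_le fun k => ((hv k).1.2.1 x hx).2
  have hwk : ∀ k, ∀ x ∈ Ω, v k x ≤ w x := fun k x hx => le_ciSup (hbdd x hx) k
  have hw0 : ∀ x ∈ Ω, 0 ≤ w x := fun x hx => ((hv 0).1.2.1 x hx).1.trans (hwk 0 x hx)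
  have hwt : ∀ x ∈ Ω, Tendsto (fun k => v k x) atTop (𝓝 (w x)) := fun x hx =>
    tendsto_atTop_ciSup (hmono x) (hbdd x hx)
  have hvm : ∀ k, Measurable (v k) := fun k => (hv k).1.1.1.1
  have hwm : Measurable w := Measurable.iSup hvm
  have hfatou : vModular p Ω w ≤ liminf (fun k => vModular p Ω (v k)) atTop := by
    unfold vModular
    refine le_trans ?_ (lintegral_liminf_le fun k => measurable_integrand hpm (hvm k))
    refine setLIntegral_mono' hΩ.measurableSet (fun x hx => ?_)
    have : Tendsto (fun k => ENNReal.ofReal (|v k x| ^ p x)) atTop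
        (𝓝 (ENNReal.ofReal (|w x| ^ p x))) :=
      ENNReal.tendsto_ofReal ((hwt x hx).abs.rpow_const (Or.inr (by linarith [(hp x hx).1])))
    exact this.liminf_eq.ge
  have hST' : S + ε < ⊤ := ENNReal.add_lt_top.2 ⟨lt_top_iff_ne_top.2 hST, ENNReal.coe_lt_top⟩
  have hwfin : vModular p Ω w < ⊤ := by
    refine hfatou.trans_lt (lt_of_le_of_lt ?_ hST')
    refine (liminf_le_liminf (Eventually.of_forall fun k => le_self_add.trans (hF k))).trans ?_
    rw [liminf_const]
  have hwL : MemLpVar p Ω w := (memLpVar_iff hΩ hp w).2 ⟨hwm, hwfin⟩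
  have hconv : Tendsto (fun k => vModular p Ω (fun x => v k x - w x)) atTop (𝓝 0) := by
    have h0 : ∫⁻ x in Ω, (0 : ℝ≥0∞) = 0 := by simp
    unfold vModular
    rw [← h0]
    refine tendsto_lintegral_of_dominated_convergence
      (fun x => ENNReal.ofReal (|w x| ^ p x))
      (fun k => measurable_integrand hpm ((hvm k).sub hwm)) (fun k => ?_) hwfin.ne ?_
    · filter_upwards [ae_restrict_mem hΩ.measurableSet] with x hx
      refine ENNReal.ofReal_le_ofReal (Real.rpow_le_rpow (abs_nonneg _) ?_
        (by linarith [(hp x hx).1]))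
      rw [abs_of_nonneg (hw0 x hx), abs_le]
      have a1 := hwk k x hx
      have a2 := ((hv k).1.2.1 x hx).1
      have a3 := hw0 x hx
      constructor <;> linarith
    · filter_upwards [ae_restrict_mem hΩ.measurableSet] with x hx
      have hpx := (hp x hx).1
      have h1 : Tendsto (fun k => |v k x - w x|) atTop (𝓝 0) := by
        simpa using ((hwt x hx).sub_const (w x)).abs
      have h2 := ENNReal.tendsto_ofReal (h1.rpow_const (p := p x) (Or.inr (by linarith)))
      rwa [Real.zero_rpow (by linarith), ENNReal.ofReal_zero] at h2
  have hlsc := bvModular_lsc hΩ hpm hp (fun k => (hv k).1.1.1) (fun k => (hv k).1.1.2.ne) hconv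
  have hfinal : vModular p Ω w + bvModular p Ω w ≤ S + ε :=
    (add_le_add hfatou hlsc).trans (liminf_add_liminf_le tendsto_const_nhds hF)
  refine (bvCapacity_le (u := w) ⟨⟨hwL, (le_add_self.trans hfinal).trans_lt hST'⟩,
    fun x hx => ⟨hw0 x hx, hw1 x hx⟩, ?_⟩).trans hfinal
  choose U hU hEU hU1 using fun k => (hv k).1.2.2
  refine ⟨⋃ k, U k, isOpen_iUnion hU, iUnion_mono hEU, ?_⟩
  rintro x ⟨hx, hxΩ⟩
  obtain ⟨k, hk⟩ := mem_iUnion.1 hx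
  refine le_antisymm (hw1 x hxΩ) ?_
  rw [← hU1 k x ⟨hk, hxΩ⟩]
  exact hwk k x hxΩ

/-- An open set containing the compact box `∏ [0, m i]` contains a cylinder. -/
theorem exists_cylinder_subset {m : ℕ → ℕ} {V : Set (ℕ → ℕ)} (hV : IsOpen V)
    (h : {x : ℕ → ℕ | ∀ i, x i ≤ m i} ⊆ V) :
    ∃ k, {x : ℕ → ℕ | ∀ i < k, x i ≤ m i} ⊆ V := by
  by_contra! hcon
  have hcon' : ∀ k, ∃ x : ℕ → ℕ, (∀ i < k, x i ≤ m i) ∧ x ∉ V := fun k => by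
    obtain ⟨x, h1, h2⟩ := not_subset.1 (hcon k)
    exact ⟨x, h1, h2⟩
  choose x hx hxV using hcon'
  have hK : IsCompact {x : ℕ → ℕ | ∀ i, x i ≤ m i} := by
    have := isCompact_univ_pi (fun i : ℕ => (Set.finite_Iic (m i)).isCompact)
    convert this using 1
    ext y; simp [Pi.le_def]
  obtain ⟨a, ha, φ, hφ, hlim⟩ := hK.tendsto_subseq (x := fun k i => min (x k i) (m i))
    (fun k i => min_le_right _ _)
  have hlim' : Tendsto (fun j => x (φ j)) atTop (𝓝 a) := by
    rw [tendsto_pi_nhds] at hlim ⊢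
    intro i
    refine (hlim i).congr' ?_
    filter_upwards [eventually_gt_atTop i] with j hj
    exact min_eq_left (hx (φ j) i (lt_of_lt_of_le hj (hφ.id_le j)))
  obtain ⟨j, hj⟩ := (hlim'.eventually (hV.mem_nhds (h ha))).exists
  exact hxV _ hj

theorem bvCapacity_inner {n : ℕ} {p : Eu n → ℝ} {Ω : Set (Eu n)} (hΩ : IsOpen Ω)
    (hpm : Measurable p) {M : ℝ} (hp : ∀ x ∈ Ω, 1 ≤ p x ∧ p x ≤ M)
    {E : Set (Eu n)} (hE : MeasurableSet E) {t : ℝ≥0∞} (ht : t < bvCapacity p Ω E) :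
    ∃ K, IsCompact K ∧ K ⊆ E ∧ t ≤ bvCapacity p Ω K := by
  have hA := hE.analyticSet
  rw [AnalyticSet] at hA
  rcases hA with rfl | ⟨f, hf, rfl⟩
  · exact ⟨∅, isCompact_empty, Subset.rfl, ht.le⟩
  let Q : List ℕ → Set (ℕ → ℕ) := fun l => {x | ∀ i, ∀ h : i < l.length, x i ≤ l[i]}
  have hstep : ∀ l : {l : List ℕ // t < bvCapacity p Ω (f '' Q l)},
      ∃ a : ℕ, t < bvCapacity p Ω (f '' Q (l.1 ++ [a])) := by
    rintro ⟨l, hl⟩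
    have hU : f '' Q l = ⋃ a : ℕ, f '' Q (l ++ [a]) := by
      rw [← image_iUnion]
      congr 1
      ext x
      simp only [mem_iUnion]
      constructor
      · intro hx
        refine ⟨x l.length, fun i hi => ?_⟩
        rw [List.getElem_append]
        split_ifs with h
        · exact hx i h
        · have : i = l.length := by
            simp at hi; omega
          simp [this]
      · rintro ⟨a, hx⟩ i hi
        have := hx i (by simp; omega)
        rwa [List.getElem_append_left hi] at this
    have hmono : Monotone (fun a : ℕ => f '' Q (l ++ [a])) := by
      intro a b hab
      refine image_mono (fun x hx i hi => ?_)
      have := hx i (by simpa using hi)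
      rw [List.getElem_append] at this ⊢
      split_ifs at this ⊢ with h
      · exact this
      · simp at this ⊢; omega
    rw [hU, bvCapacity_iUnion hΩ hpm hp hmono, lt_iSup_iff] at hl
    exact hl
  choose a ha using hstep
  let L : ℕ → {l : List ℕ // t < bvCapacity p Ω (f '' Q l)} := fun k =>
    Nat.rec ⟨[], by
      have : Q [] = univ := by ext x; simp [Q]
      rw [this, image_univ]; exact ht⟩ (fun _ l => ⟨l.1 ++ [a l], ha l⟩) k
  have hL : ∀ k, (L (k + 1)).1 = (L k).1 ++ [a (L k)] := fun k => rfl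
  have hlen : ∀ k, (L k).1.length = k := by
    intro k
    induction k with
    | zero => rfl
    | succ k ih => rw [hL]; simp [ih]
  let m : ℕ → ℕ := fun k => a (L k)
  have hget : ∀ k i (h : i < (L k).1.length), (L k).1[i] = m i := by
    intro k
    induction k with
    | zero => intro i h; rw [hlen] at h; omega
    | succ k ih =>
      intro i h
      have h' : i < k + 1 := (hlen (k + 1)) ▸ h
      simp only [hL]
      rw [List.getElem_append]
      split_ifs with h2
      · exact ih i h2
      · have : i = k := by rw [hlen] at h2; omega
        subst this
        simp [m]
  have hQ : ∀ k, Q (L k).1 = {x : ℕ → ℕ | ∀ i < k, x i ≤ m i} := by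
    intro k
    ext x
    constructor
    · intro hx i hi
      have hi' : i < (L k).1.length := by rwa [hlen]
      have := hx i hi'
      rwa [hget k i hi'] at this
    · intro hx i hi
      rw [hget k i hi]
      exact hx i (by rwa [hlen] at hi)
  have hK : IsCompact {x : ℕ → ℕ | ∀ i, x i ≤ m i} := by
    have := isCompact_univ_pi (fun i : ℕ => (Set.finite_Iic (m i)).isCompact)
    convert this using 1
    ext y; simp [Pi.le_def]
  refine ⟨f '' {x : ℕ → ℕ | ∀ i, x i ≤ m i}, hK.image hf, image_subset_range _ _, ?_⟩
  by_contra! hlt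
  obtain ⟨U, hU, hKU, hUt⟩ := bvCapacity_outer hlt
  obtain ⟨k, hk⟩ := exists_cylinder_subset (hU.preimage hf) (image_subset_iff.1 hKU)
  have h1 := (L k).2
  rw [hQ k] at h1
  exact absurd (h1.trans_le (bvCapacity_mono (image_subset_iff.2 hk))) hUt.le.not_gt

/-- the mixed capacity is a Choquet capacity: it is monotone,
continuous along increasing sequences of sets and decreasing sequences of
compact sets; in particular, for every Borel `E ⊆ Ω` its capacity is the
supremum over compact subsets and the infimum over open supersets. -/
theorem bvCapacity_choquet
    {n : ℕ} (p : Eu n → ℝ) (Ω : Set (Eu n)) (hΩ : IsOpen Ω)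
    (hpm : Measurable p) (hp1 : ∀ x ∈ Ω, 1 ≤ p x) (hpb : ∃ M : ℝ, ∀ x ∈ Ω, p x ≤ M) :
    (∀ E₁ E₂ : Set (Eu n), E₁ ⊆ E₂ → E₂ ⊆ Ω →
      bvCapacity p Ω E₁ ≤ bvCapacity p Ω E₂) ∧
    (∀ E : ℕ → Set (Eu n), Monotone E → (∀ i, E i ⊆ Ω) →
      Tendsto (fun i => bvCapacity p Ω (E i)) atTop
        (𝓝 (bvCapacity p Ω (⋃ i, E i)))) ∧
    (∀ K : ℕ → Set (Eu n), Antitone K → (∀ i, IsCompact (K i) ∧ K i ⊆ Ω) →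
      Tendsto (fun i => bvCapacity p Ω (K i)) atTop
        (𝓝 (bvCapacity p Ω (⋂ i, K i)))) ∧
    (∀ E : Set (Eu n), MeasurableSet E → E ⊆ Ω →
      bvCapacity p Ω E =
        (⨆ (K : Set (Eu n)) (_ : IsCompact K ∧ K ⊆ E), bvCapacity p Ω K) ∧
      bvCapacity p Ω E =
        ⨅ (U : Set (Eu n)) (_ : IsOpen U ∧ E ⊆ U ∧ U ⊆ Ω), bvCapacity p Ω U) := by
  obtain ⟨M, hM⟩ := hpb
  have hp : ∀ x ∈ Ω, 1 ≤ p x ∧ p x ≤ M := fun x hx => ⟨hp1 x hx, hM x hx⟩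
  refine ⟨fun E₁ E₂ h _ => bvCapacity_mono h, ?_, ?_, ?_⟩
  · intro E hE _
    rw [bvCapacity_iUnion hΩ hpm hp hE]
    exact tendsto_atTop_iSup fun i j hij => bvCapacity_mono (hE hij)
  · intro K hK hKc
    have heq : bvCapacity p Ω (⋂ i, K i) = ⨅ i, bvCapacity p Ω (K i) := by
      refine le_antisymm (le_iInf fun i => bvCapacity_mono (iInter_subset K i)) ?_
      refine le_of_forall_gt fun c hc => ?_
      obtain ⟨U, hU, hKU, hUc⟩ := bvCapacity_outer hc
      obtain ⟨i, hi⟩ := exists_subset_nhds_of_isCompact (V := K) (U := U)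
        (directed_of_isDirected_le fun i j hij => hK hij) (fun i => (hKc i).1)
        (fun x hx => hU.mem_nhds (hKU hx))
      exact (iInf_le _ i).trans_lt ((bvCapacity_mono hi).trans_lt hUc)
    rw [heq]
    exact tendsto_atTop_iInf fun i j hij => bvCapacity_mono (hK hij)
  · intro E hE hEΩ
    constructor
    · refine le_antisymm ?_ (iSup₂_le fun K hK => bvCapacity_mono hK.2)
      refine le_of_forall_lt fun t ht => ?_
      obtain ⟨s, hts, hs⟩ := exists_between ht
      obtain ⟨K, hK, hKE, hsK⟩ := bvCapacity_inner hΩ hpm hp hE hs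
      exact (hts.trans_le hsK).trans_le
        (le_iSup₂ (f := fun (K : Set (Eu n)) (_ : IsCompact K ∧ K ⊆ E) => bvCapacity p Ω K)
          K ⟨hK, hKE⟩)
    · refine le_antisymm (le_iInf₂ fun U hU => bvCapacity_mono hU.2.1) ?_
      refine le_of_forall_gt fun c hc => ?_
      obtain ⟨U, hU, hEU, hUc⟩ := bvCapacity_outer hc
      exact (iInf₂_le (U ∩ Ω) ⟨hU.inter hΩ, subset_inter hEU hEΩ, inter_subset_right⟩).trans_lt
        ((bvCapacity_mono inter_subset_left).trans_lt hUc)
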